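/- Let σ be the ℂ-algebra automorphism of ℂ[w,u,v] determined by σ(w) = −w, σ(u) = i·u, σ(v) = i·v. Then the subalgebra of σ-fixed elements of ℂ[w,u,v] equals the ℂ-subalgebra generated by the nine polynomials v⁴, v³u, v²u², vu³, u⁴, wu², wuv, wv², w². -/

import Mathlib

open MvPolynomial

theorem monomial_fin_three (d : Fin 3 →₀ ℕ) (c : ℂ) :
    (monomial d c : MvPolynomial (Fin 3) ℂ) =
      C c * (X 0 ^ d 0 * X 1 ^ d 1 * X 2 ^ d 2) := by
  rw [monomial_eq, Finsupp.prod_fintype _ _ (fun _ => pow_zero _), Fin.prod_univ_three]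

/-- A diagonal automorphism with weights `(-1, i, i)` scales each coefficient by a power of `i`. -/
theorem coeff_apply_of_diag_neg1_i_i
    (σ : MvPolynomial (Fin 3) ℂ ≃ₐ[ℂ] MvPolynomial (Fin 3) ℂ)
    (hw : σ (X 0) = -X 0)
    (hu : σ (X 1) = C Complex.I * X 1)
    (hv : σ (X 2) = C Complex.I * X 2)
    (p : MvPolynomial (Fin 3) ℂ) (d : Fin 3 →₀ ℕ) :
    coeff d (σ p) = Complex.I ^ (2 * d 0 + d 1 + d 2) * coeff d p := by
  classical
  induction p using MvPolynomial.induction_on' with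
  | monomial e c =>
    have hσC : σ (C c) = C c := σ.commutes c
    have hw' : σ (X 0) = C (Complex.I ^ 2) * X 0 := by
      rw [hw, Complex.I_sq, C_neg, C_1, neg_one_mul]
    have h : σ (monomial e c) = monomial e (Complex.I ^ (2 * e 0 + e 1 + e 2) * c) := by
      rw [monomial_fin_three, monomial_fin_three]
      simp only [map_mul, map_pow, hσC, hw', hu, hv]
      ring
    rw [h, coeff_monomial, coeff_monomial]
    split_ifs with hed
    · rw [hed]
    · rw [mul_zero]
  | add p q hp hq => rw [map_add, coeff_add, coeff_add, hp, hq, mul_add]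

theorem Complex.I_pow_eq_one_iff (n : ℕ) : Complex.I ^ n = 1 ↔ 4 ∣ n := by
  constructor
  · intro h
    rw [Complex.I_pow_eq_pow_mod] at h
    have hlt : n % 4 < 4 := Nat.mod_lt _ (by norm_num)
    apply Nat.dvd_of_mod_eq_zero
    generalize n % 4 = r at h hlt
    interval_cases r
    · rfl
    · simp [Complex.ext_iff] at h
    · norm_num [Complex.ext_iff] at h
    · simp [Complex.ext_iff, pow_succ] at h
  · rintro ⟨k, rfl⟩
    rw [pow_mul, Complex.I_pow_four, one_pow]

/-- If a submonoid contains the nine basic invariant monomials, then it contains every monomial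
whose weight `2a + b + c` is divisible by four. -/
theorem Submonoid.pow_mul_pow_mul_pow_mem {M : Type*} [CommMonoid M] (S : Submonoid M)
    {w u v : M} (h1 : v ^ 4 ∈ S) (h2 : v ^ 3 * u ∈ S) (h3 : v ^ 2 * u ^ 2 ∈ S)
    (h4 : v * u ^ 3 ∈ S) (h5 : u ^ 4 ∈ S) (h6 : w * u ^ 2 ∈ S) (h7 : w * u * v ∈ S)
    (h8 : w * v ^ 2 ∈ S) (h9 : w ^ 2 ∈ S) (a b c : ℕ) (h : 4 ∣ 2 * a + b + c) :
    w ^ a * u ^ b * v ^ c ∈ S := by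
  induction hn : a + b + c using Nat.strong_induction_on generalizing a b c with
  | _ n ih =>
    have key (a₀ b₀ c₀ : ℕ) (hm : w ^ a₀ * u ^ b₀ * v ^ c₀ ∈ S) (ha : a₀ ≤ a) (hb : b₀ ≤ b)
        (hc : c₀ ≤ c) (hd : 4 ∣ 2 * a₀ + b₀ + c₀) (hpos : 0 < a₀ + b₀ + c₀) :
        w ^ a * u ^ b * v ^ c ∈ S := by
      have h' := ih ((a - a₀) + (b - b₀) + (c - c₀)) (by omega) (a - a₀) (b - b₀) (c - c₀)
        (by omega) rfl
      have hmul := S.mul_mem hm h'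
      rwa [mul_mul_mul_comm, mul_mul_mul_comm (w ^ a₀), ← pow_add, ← pow_add, ← pow_add,
        Nat.add_sub_cancel' ha, Nat.add_sub_cancel' hb, Nat.add_sub_cancel' hc] at hmul
    have hcases : (a = 0 ∧ b = 0 ∧ c = 0) ∨ 2 ≤ a ∨ (1 ≤ a ∧ 2 ≤ b) ∨
        (1 ≤ a ∧ 1 ≤ b ∧ 1 ≤ c) ∨ (1 ≤ a ∧ 2 ≤ c) ∨ 4 ≤ b ∨ (3 ≤ b ∧ 1 ≤ c) ∨
        (2 ≤ b ∧ 2 ≤ c) ∨ (1 ≤ b ∧ 3 ≤ c) ∨ 4 ≤ c := by omega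
    rcases hcases with ⟨rfl, rfl, rfl⟩ | h | h | h | h | h | h | h | h | h
    · simp
    · exact key 2 0 0 (by simpa using h9) (by omega) (by omega) (by omega) (by omega) (by omega)
    · exact key 1 2 0 (by simpa using h6) (by omega) (by omega) (by omega) (by omega) (by omega)
    · exact key 1 1 1 (by simpa using h7) (by omega) (by omega) (by omega) (by omega) (by omega)
    · exact key 1 0 2 (by simpa using h8) (by omega) (by omega) (by omega) (by omega) (by omega)
    · exact key 0 4 0 (by simpa using h5) (by omega) (by omega) (by omega) (by omega) (by omega)
    · exact key 0 3 1 (by simpa [mul_comm] using h4)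
        (by omega) (by omega) (by omega) (by omega) (by omega)
    · exact key 0 2 2 (by simpa [mul_comm] using h3)
        (by omega) (by omega) (by omega) (by omega) (by omega)
    · exact key 0 1 3 (by simpa [mul_comm] using h2)
        (by omega) (by omega) (by omega) (by omega) (by omega)
    · exact key 0 0 4 (by simpa using h1) (by omega) (by omega) (by omega) (by omega) (by omega)

/-- Let `σ` be the ℂ-algebra automorphism of `ℂ[w,u,v]` (with `w = X 0`, `u = X 1`,
`v = X 2`) determined by `σ(w) = −w`, `σ(u) = i·u`, `σ(v) = i·v`.  Then the fixed
subalgebra of `σ` equals the ℂ-subalgebra generated by the nine polynomials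
`v⁴, v³u, v²u², vu³, u⁴, wu², wuv, wv², w²`. -/
theorem fixed_subalgebra_diag_neg1_i_i
    (σ : MvPolynomial (Fin 3) ℂ ≃ₐ[ℂ] MvPolynomial (Fin 3) ℂ)
    (hw : σ (X 0) = -X 0)
    (hu : σ (X 1) = C Complex.I * X 1)
    (hv : σ (X 2) = C Complex.I * X 2) :
    ∀ p : MvPolynomial (Fin 3) ℂ, σ p = p ↔
      p ∈ Algebra.adjoin ℂ
        ({X 2 ^ 4, X 2 ^ 3 * X 1, X 2 ^ 2 * X 1 ^ 2, X 2 * X 1 ^ 3, X 1 ^ 4,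
          X 0 * X 1 ^ 2, X 0 * X 1 * X 2, X 0 * X 2 ^ 2, X 0 ^ 2} :
          Set (MvPolynomial (Fin 3) ℂ)) := by
  intro p
  constructor
  · intro hp
    rw [p.as_sum]
    refine Subalgebra.sum_mem _ fun d hd => ?_
    have hcoeff := coeff_apply_of_diag_neg1_i_i σ hw hu hv p d
    rw [hp] at hcoeff
    have hdvd : 4 ∣ 2 * d 0 + d 1 + d 2 := by
      rw [← Complex.I_pow_eq_one_iff]
      exact (right_eq_mul₀ (mem_support_iff.mp hd)).mp hcoeff
    rw [monomial_fin_three]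
    refine Subalgebra.mul_mem _ (Subalgebra.algebraMap_mem _ _) ?_
    refine Submonoid.pow_mul_pow_mul_pow_mem (M := MvPolynomial (Fin 3) ℂ)
      (Algebra.adjoin ℂ _).toSubsemiring.toSubmonoid
      ?_ ?_ ?_ ?_ ?_ ?_ ?_ ?_ ?_ _ _ _ hdvd <;>
    exact Algebra.subset_adjoin (by simp)
  · intro hp
    have hI : (C Complex.I : MvPolynomial (Fin 3) ℂ) ^ 2 = -1 := by
      rw [← C_pow, Complex.I_sq, C_neg, C_1]
    induction hp using Algebra.adjoin_induction with
    | mem x hx =>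
      simp only [Set.mem_insert_iff, Set.mem_singleton_iff] at hx
      rcases hx with rfl | rfl | rfl | rfl | rfl | rfl | rfl | rfl | rfl <;>
      simp only [map_mul, map_pow, hw, hu, hv] <;> grind
    | algebraMap r => exact σ.commutes r
    | add x y _ _ hx hy => rw [map_add, hx, hy]
    | mul x y _ _ hx hy => rw [map_mul, hx, hy]
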